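/- Fermionic contraction formula (Lemma 3.4, discrete-mode form): for all n_A, m_A, n_B, m_B ∈ ℕ and all finitely supported kernels f_A : (Fin n_A → ι) × (Fin m_A → ι) → ℂ and f_B : (Fin n_B → ι) × (Fin m_B → ι) → ℂ, one has Op(f_A) * Op(f_B) = (−1)^{m_A · n_B} · :Op(f_A)Op(f_B): + Op(f_A) Γ₋ Op(f_B). -/

import Mathlib

open scoped Classical

noncomputable section

/-- The unique permutation `σ` of `Fin n` taking the contraction `π` into maximally
crossed form: `σ (π c)` has value `n − 1 − c` (i.e. `σ` sends the `c`-th contracted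
connector to the `c`-th top-most position), and `σ` is strictly increasing on the
complement of the range of `π`.  (Defined by choice; for injective `π` such a
permutation exists and is unique.) -/
def maxCrossPerm {n C : ℕ} (π : Fin C → Fin n) : Equiv.Perm (Fin n) :=
  if h : ∃ σ : Equiv.Perm (Fin n),
      (∀ c : Fin C, ((σ (π c) : Fin n) : ℕ) = n - 1 - (c : ℕ)) ∧
      ∀ u₁ u₂ : Fin n, u₁ ∉ Set.range π → u₂ ∉ Set.range π → u₁ < u₂ → σ u₁ < σ u₂
  then h.choose else 1

/-- The sign `sgn(π, π', m, n) = (−1)^{(m−C)(n−C)} · sign σ · sign σ'` of a contraction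
configuration. -/
def configSign {m n C : ℕ} (π : Fin C → Fin n) (π' : Fin C → Fin m) : ℤ :=
  (-1) ^ ((m - C) * (n - C)) *
    ((Equiv.Perm.sign (maxCrossPerm π) : ℤˣ) : ℤ) *
    ((Equiv.Perm.sign (maxCrossPerm π') : ℤˣ) : ℤ)

variable {ι : Type*} [DecidableEq ι] {R : Type*} [Ring R] [Algebra ℂ R]

/-- `FOp a adag f` is the normal ordered operator
`Σ_{(X,Y)} f(X,Y) · a⁺_{X n} ⋯ a⁺_{X 1} · a_{Y 1} ⋯ a_{Y m}` associated with a finitely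
supported kernel `f`. -/
def FOp (a adag : ι → R) {n m : ℕ} (f : ((Fin n → ι) × (Fin m → ι)) →₀ ℂ) : R :=
  f.sum fun XY c =>
    c • ((List.ofFn fun i => adag (XY.1 i)).reverse.prod *
         (List.ofFn fun j => a (XY.2 j)).prod)

/-- The normal ordered product `:Op(f_A)Op(f_B):`. -/
def FNormal (a adag : ι → R) {nA mA nB mB : ℕ}
    (fA : ((Fin nA → ι) × (Fin mA → ι)) →₀ ℂ)
    (fB : ((Fin nB → ι) × (Fin mB → ι)) →₀ ℂ) : R :=
  fA.sum fun XYA cA => fB.sum fun XYB cB =>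
    (cA * cB) •
      ((List.ofFn fun i => adag (XYA.1 i)).reverse.prod *
       (List.ofFn fun i => adag (XYB.1 i)).reverse.prod *
       (List.ofFn fun j => a (XYA.2 j)).prod *
       (List.ofFn fun j => a (XYB.2 j)).prod)

/-- The fermionic attached product `Op(f_A) Γ₋ Op(f_B)`: a signed sum over all contraction
configurations `(π, π')`, where `π` (strictly decreasing) picks left connectors of `B`
and `π'` (injective) picks right connectors of `A`. Uncontracted connectors keep their
order (contracted ones are replaced by the unit `1` inside the ordered products). -/
def FAttachF (a adag : ι → R) {nA mA nB mB : ℕ}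
    (fA : ((Fin nA → ι) × (Fin mA → ι)) →₀ ℂ)
    (fB : ((Fin nB → ι) × (Fin mB → ι)) →₀ ℂ) : R :=
  ∑ C ∈ Finset.Icc 1 (min mA nB),
    ∑ π ∈ Finset.univ.filter (fun π : Fin C → Fin nB => StrictAnti π),
      ∑ π' ∈ Finset.univ.filter (fun π' : Fin C → Fin mA => Function.Injective π'),
        fA.sum fun XYA cA => fB.sum fun XYB cB =>
          ((configSign π π' : ℂ) * cA * cB *
              ∏ c : Fin C, if XYB.1 (π c) = XYA.2 (π' c) then (1 : ℂ) else 0) •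
            ((List.ofFn fun i => adag (XYA.1 i)).reverse.prod *
             (List.ofFn fun i : Fin nB =>
                if ∃ c, π c = i then (1 : R) else adag (XYB.1 i)).reverse.prod *
             (List.ofFn fun j : Fin mA =>
                if ∃ c, π' c = j then (1 : R) else a (XYA.2 j)).prod *
             (List.ofFn fun j => a (XYB.2 j)).prod)

/-- The defining property of `maxCrossPerm π`. -/
def IsMaxCross {n C : ℕ} (π : Fin C → Fin n) (σ : Equiv.Perm (Fin n)) : Prop :=
  (∀ c : Fin C, ((σ (π c) : Fin n) : ℕ) = n - 1 - (c : ℕ)) ∧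
    ∀ u₁ u₂ : Fin n, u₁ ∉ Set.range π → u₂ ∉ Set.range π → u₁ < u₂ → σ u₁ < σ u₂

lemma IsMaxCross.eq {n C : ℕ} {π : Fin C → Fin n} {σ τ : Equiv.Perm (Fin n)}
    (hσ : IsMaxCross π σ) (hτ : IsMaxCross π τ) : σ = τ := by
  have agree : ∀ c, σ (π c) = τ (π c) := fun c => Fin.ext ((hσ.1 c).trans (hτ.1 c).symm)
  have range_eq : ∀ ρ : Equiv.Perm (Fin n),
      Set.range (fun u : {u : Fin n // u ∉ Set.range π} => ρ u) =
        (Set.range fun c => ρ (π c))ᶜ := by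
    intro ρ
    ext v
    obtain ⟨w, rfl⟩ := ρ.surjective v
    simp
  have mono : ∀ ρ, IsMaxCross π ρ →
      StrictMono (fun u : {u : Fin n // u ∉ Set.range π} => ρ u) :=
    fun ρ hρ u v h => hρ.2 u v u.2 v.2 h
  have key : (fun u : {u : Fin n // u ∉ Set.range π} => σ u) =
      fun u : {u : Fin n // u ∉ Set.range π} => τ u := by
    refine ((mono σ hσ).range_inj (mono τ hτ)).1 ?_
    rw [range_eq, range_eq]
    simp only [agree]
  ext u : 1
  by_cases hu : u ∈ Set.range π
  · obtain ⟨c, rfl⟩ := hu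
    exact agree c
  · exact congrFun key ⟨u, hu⟩

lemma IsMaxCross.maxCrossPerm_eq {n C : ℕ} {π : Fin C → Fin n} {σ : Equiv.Perm (Fin n)}
    (hσ : IsMaxCross π σ) : maxCrossPerm π = σ := by
  have h : ∃ σ, IsMaxCross π σ := ⟨σ, hσ⟩
  have hm : maxCrossPerm π = h.choose := dif_pos h
  rw [hm]
  exact h.choose_spec.eq hσ

/-- The permutation sending `j` to the top position and acting as `σ` on the other elements. -/
def raiseToTop {n : ℕ} (j : Fin (n + 1)) (σ : Equiv.Perm (Fin n)) : Equiv.Perm (Fin (n + 1)) :=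
  (finRotate (n + 1)).symm * Equiv.Perm.decomposeFin.symm (0, σ) * j.cycleRange

lemma raiseToTop_self {n : ℕ} (j : Fin (n + 1)) (σ : Equiv.Perm (Fin n)) :
    raiseToTop j σ j = Fin.last n := by
  simp [raiseToTop, Equiv.symm_apply_eq, -finRotate_symm_apply]

lemma raiseToTop_succAbove {n : ℕ} (j : Fin (n + 1)) (σ : Equiv.Perm (Fin n)) (i : Fin n) :
    raiseToTop j σ (j.succAbove i) = (σ i).castSucc := by
  simp [raiseToTop, Equiv.symm_apply_eq, -finRotate_symm_apply]

lemma sign_raiseToTop {n : ℕ} (j : Fin (n + 1)) (σ : Equiv.Perm (Fin n)) :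
    Equiv.Perm.sign (raiseToTop j σ) = (-1) ^ (n + j : ℕ) * Equiv.Perm.sign σ := by
  simp only [raiseToTop, map_mul, Equiv.Perm.sign_symm, sign_finRotate, Fin.sign_cycleRange,
    Equiv.Perm.decomposeFin.symm_sign, if_true, pow_add]
  rw [one_mul, mul_assoc, mul_assoc, mul_comm (Equiv.Perm.sign σ), Nat.add_sub_cancel]

/-- Prepend `j` to a map into `Fin n`, viewed as a map into the complement of `j`. -/
def consAbove {n C : ℕ} (j : Fin (n + 1)) (π : Fin C → Fin n) : Fin (C + 1) → Fin (n + 1) :=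
  Fin.cons j (j.succAbove ∘ π)

@[simp] lemma consAbove_zero {n C : ℕ} (j : Fin (n + 1)) (π : Fin C → Fin n) :
    consAbove j π 0 = j := rfl

@[simp] lemma consAbove_succ {n C : ℕ} (j : Fin (n + 1)) (π : Fin C → Fin n) (c : Fin C) :
    consAbove j π c.succ = j.succAbove (π c) := rfl

lemma consAbove_injective {n C : ℕ} (j : Fin (n + 1)) {π : Fin C → Fin n}
    (hπ : Function.Injective π) : Function.Injective (consAbove j π) := by
  refine Fin.cons_injective_iff.2 ⟨?_, Fin.succAbove_right_injective.comp hπ⟩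
  rintro ⟨c, hc⟩
  exact Fin.succAbove_ne _ _ hc

lemma exists_eq_consAbove {n C : ℕ} {π : Fin (C + 1) → Fin (n + 1)} (hπ : Function.Injective π) :
    ∃ π₁ : Fin C → Fin n, Function.Injective π₁ ∧ π = consAbove (π 0) π₁ := by
  have hne : ∀ c : Fin C, π c.succ ≠ π 0 := fun c h => Fin.succ_ne_zero c (hπ h)
  choose π₁ h₁ using fun c => Fin.exists_succAbove_eq (hne c)
  refine ⟨π₁, fun c d hcd => ?_, ?_⟩
  · exact Fin.succ_injective _ (hπ (by rw [← h₁ c, ← h₁ d, hcd]))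
  · funext c
    refine Fin.cases rfl (fun c => ?_) c
    rw [consAbove_succ, h₁]

lemma IsMaxCross.consAbove {n C : ℕ} {π : Fin C → Fin n} {σ : Equiv.Perm (Fin n)}
    (hσ : IsMaxCross π σ) (j : Fin (n + 1)) : IsMaxCross (consAbove j π) (raiseToTop j σ) := by
  refine ⟨fun c => ?_, fun u₁ u₂ h₁ h₂ h => ?_⟩
  · refine Fin.cases ?_ (fun c => ?_) c
    · simp [raiseToTop_self]
    · rw [consAbove_succ, raiseToTop_succAbove]
      simp only [Fin.val_castSucc, hσ.1 c, Fin.val_succ]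
      omega
  · have lift : ∀ u, u ∉ Set.range (_root_.consAbove j π) →
        ∃ v, j.succAbove v = u ∧ v ∉ Set.range π := by
      intro u hu
      obtain ⟨v, rfl⟩ := Fin.exists_succAbove_eq (fun e : u = j => hu ⟨0, e.symm⟩)
      refine ⟨v, rfl, ?_⟩
      rintro ⟨c, rfl⟩
      exact hu ⟨c.succ, rfl⟩
    obtain ⟨v₁, rfl, hv₁⟩ := lift u₁ h₁
    obtain ⟨v₂, rfl, hv₂⟩ := lift u₂ h₂
    rw [raiseToTop_succAbove, raiseToTop_succAbove, Fin.castSucc_lt_castSucc_iff]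
    exact hσ.2 _ _ hv₁ hv₂ ((Fin.strictMono_succAbove j).lt_iff_lt.1 h)

lemma isMaxCross_one {n : ℕ} (π : Fin 0 → Fin n) : IsMaxCross π 1 :=
  ⟨fun c => c.elim0, fun _ _ _ _ h => h⟩

lemma exists_isMaxCross {C : ℕ} : ∀ {n : ℕ} {π : Fin C → Fin n}, Function.Injective π →
    ∃ σ, IsMaxCross π σ := by
  induction C with
  | zero => exact fun _ => ⟨1, isMaxCross_one _⟩
  | succ C ih =>
    intro n π hπ
    obtain _ | n := n
    · exact (π 0).elim0
    · obtain ⟨π₁, h₁, he⟩ := exists_eq_consAbove hπ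
      obtain ⟨σ, hσ⟩ := ih h₁
      rw [he]
      exact ⟨_, hσ.consAbove _⟩

lemma maxCrossPerm_of_isEmpty {n : ℕ} (π : Fin 0 → Fin n) : maxCrossPerm π = 1 :=
  (isMaxCross_one π).maxCrossPerm_eq

lemma sign_maxCrossPerm_consAbove {n C : ℕ} (j : Fin (n + 1)) {π : Fin C → Fin n}
    (hπ : Function.Injective π) :
    Equiv.Perm.sign (maxCrossPerm (consAbove j π)) =
      (-1) ^ (n + j : ℕ) * Equiv.Perm.sign (maxCrossPerm π) := by
  obtain ⟨σ, hσ⟩ := exists_isMaxCross hπ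
  rw [(hσ.consAbove j).maxCrossPerm_eq, hσ.maxCrossPerm_eq, sign_raiseToTop]

lemma castSucc_comp_consAbove {n C : ℕ} (j : Fin (n + 1)) (π : Fin C → Fin n) :
    Fin.castSucc ∘ consAbove j π = consAbove j.castSucc (Fin.castSucc ∘ π) := by
  funext c
  refine Fin.cases rfl (fun c => ?_) c
  simp

lemma sign_maxCrossPerm_castSucc {C : ℕ} : ∀ {n : ℕ} {π : Fin C → Fin n},
    Function.Injective π →
      Equiv.Perm.sign (maxCrossPerm (Fin.castSucc ∘ π)) =
        (-1) ^ C * Equiv.Perm.sign (maxCrossPerm π) := by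
  induction C with
  | zero => intros; simp [maxCrossPerm_of_isEmpty]
  | succ C ih =>
    intro n π hπ
    obtain _ | n := n
    · exact (π 0).elim0
    · obtain ⟨π₁, h₁, he⟩ := exists_eq_consAbove hπ
      rw [he, castSucc_comp_consAbove, sign_maxCrossPerm_consAbove _ h₁,
        sign_maxCrossPerm_consAbove _ ((Fin.castSucc_injective n).comp h₁), ih h₁,
        Fin.val_castSucc]
      simp only [pow_add, pow_one]
      simp [mul_left_comm]

lemma configSign_of_isEmpty {m n : ℕ} (π : Fin 0 → Fin n) (π' : Fin 0 → Fin m) :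
    configSign π π' = (-1) ^ (m * n) := by
  simp [configSign, maxCrossPerm_of_isEmpty]

lemma configSign_castSucc {m n C : ℕ} {π : Fin C → Fin n} {π' : Fin C → Fin m}
    (hπ : Function.Injective π) (hπ' : Function.Injective π') :
    configSign (Fin.castSucc ∘ π) π' = (-1) ^ m * configSign π π' := by
  have hn : C ≤ n := by simpa using Fintype.card_le_of_injective π hπ
  have hm : C ≤ m := by simpa using Fintype.card_le_of_injective π' hπ'
  obtain ⟨p, rfl⟩ := Nat.exists_eq_add_of_le hn
  obtain ⟨q, rfl⟩ := Nat.exists_eq_add_of_le hm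
  have e : C + p + 1 - C = p + 1 := by omega
  have hC : ((-1 : ℤ) ^ C) * (-1) ^ C = 1 := by rw [← mul_pow]; simp
  simp only [configSign, sign_maxCrossPerm_castSucc hπ, e, Nat.add_sub_cancel_left]
  push_cast
  ring

lemma configSign_consAbove {m n C : ℕ} {π : Fin C → Fin n} {π' : Fin C → Fin m}
    (hπ : Function.Injective π) (hπ' : Function.Injective π') (j : Fin (m + 1)) :
    configSign (consAbove (Fin.last n) π) (consAbove j π') =
      (-1) ^ (m + j : ℕ) * configSign π π' := by
  have hn : ((-1 : ℤ) ^ (n + n)) = 1 := Even.neg_one_pow ⟨n, rfl⟩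
  simp only [configSign, sign_maxCrossPerm_consAbove _ hπ, sign_maxCrossPerm_consAbove _ hπ',
    Nat.add_sub_add_right, Fin.val_last]
  push_cast
  rw [hn]
  ring

lemma sum_strictAnti_succ {M : Type*} [AddCommMonoid M] {n C : ℕ}
    (F : (Fin (C + 1) → Fin (n + 1)) → M) :
    ∑ π ∈ Finset.univ.filter (fun π : Fin (C + 1) → Fin (n + 1) => StrictAnti π), F π =
      (∑ π ∈ Finset.univ.filter (fun π : Fin (C + 1) → Fin n => StrictAnti π),
        F (Fin.castSucc ∘ π)) +
      ∑ π ∈ Finset.univ.filter (fun π : Fin C → Fin n => StrictAnti π),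
        F (consAbove (Fin.last n) π) := by
  rw [← Finset.sum_filter_not_add_sum_filter _
    (fun π : Fin (C + 1) → Fin (n + 1) => π 0 = Fin.last n)]
  congr 1
  · symm
    refine Finset.sum_bij (fun π _ => Fin.castSucc ∘ π) ?_ ?_ ?_ (fun _ _ => rfl)
    · intro π hπ
      simp only [Finset.mem_filter, Finset.mem_univ, true_and] at hπ ⊢
      exact ⟨fun c d h => Fin.castSucc_lt_castSucc_iff.2 (hπ h), Fin.castSucc_ne_last _⟩
    · intro π _ ρ _ h
      exact (Fin.castSucc_injective n).comp_left h
    · intro π hπ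
      simp only [Finset.mem_filter, Finset.mem_univ, true_and] at hπ
      have hne : ∀ c, π c ≠ Fin.last n := by
        intro c hc
        have h0 := hπ.1.antitone (Fin.zero_le c)
        rw [hc] at h0
        exact hπ.2 (Fin.last_le_iff.1 h0)
      choose ρ hρ using fun c => Fin.exists_castSucc_eq.2 (hne c)
      refine ⟨ρ, ?_, funext hρ⟩
      simp only [Finset.mem_filter, Finset.mem_univ, true_and]
      intro c d h
      rw [← Fin.castSucc_lt_castSucc_iff, hρ, hρ]
      exact hπ.1 h
  · symm
    refine Finset.sum_bij (fun π _ => consAbove (Fin.last n) π) ?_ ?_ ?_ (fun _ _ => rfl)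
    · intro π hπ
      simp only [Finset.mem_filter, Finset.mem_univ, true_and] at hπ ⊢
      refine ⟨fun c d => ?_, rfl⟩
      refine Fin.cases ?_ (fun d => ?_) d
      · simp
      · refine Fin.cases ?_ (fun c => ?_) c
        · simp [Fin.castSucc_lt_last]
        · simpa using fun h => hπ h
    · intro π _ ρ _ h
      funext c
      exact Fin.succAbove_right_injective (congrFun h c.succ)
    · intro π hπ
      simp only [Finset.mem_filter, Finset.mem_univ, true_and] at hπ
      obtain ⟨ρ, -, he⟩ := exists_eq_consAbove hπ.1.injective
      rw [hπ.2] at he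
      refine ⟨ρ, ?_, he.symm⟩
      simp only [Finset.mem_filter, Finset.mem_univ, true_and]
      intro c d h
      have := hπ.1 (Fin.succ_lt_succ_iff.2 h)
      rw [he] at this
      simpa using this

lemma sum_injective_succ {M : Type*} [AddCommMonoid M] {n C : ℕ}
    (F : (Fin (C + 1) → Fin (n + 1)) → M) :
    ∑ π ∈ Finset.univ.filter (fun π : Fin (C + 1) → Fin (n + 1) => Function.Injective π), F π =
      ∑ j : Fin (n + 1),
        ∑ π ∈ Finset.univ.filter (fun π : Fin C → Fin n => Function.Injective π),
          F (consAbove j π) := by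
  rw [← Finset.sum_product']
  symm
  refine Finset.sum_bij (fun p _ => consAbove p.1 p.2) ?_ ?_ ?_ (fun _ _ => rfl)
  · intro p hp
    simp only [Finset.mem_product, Finset.mem_filter, Finset.mem_univ, true_and] at hp ⊢
    exact consAbove_injective _ hp
  · rintro ⟨j, π⟩ _ ⟨k, ρ⟩ _ h
    obtain rfl : j = k := congrFun h 0
    obtain rfl : π = ρ := funext fun c => Fin.succAbove_right_injective (congrFun h c.succ)
    rfl
  · intro π hπ
    simp only [Finset.mem_filter, Finset.mem_univ, true_and] at hπ
    obtain ⟨ρ, h, he⟩ := exists_eq_consAbove hπ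
    exact ⟨(π 0, ρ), by simpa using h, he.symm⟩

lemma prod_ofFn_succAbove {M : Type*} [Monoid M] {n : ℕ} (j : Fin (n + 1)) (g : Fin (n + 1) → M)
    (hj : g j = 1) : (List.ofFn g).prod = (List.ofFn fun i => g (j.succAbove i)).prod := by
  induction n with
  | zero =>
    obtain rfl : j = 0 := Fin.fin_one_eq_zero j
    simp [hj]
  | succ n ih =>
    induction j using Fin.cases with
    | zero => simp [List.ofFn_succ, hj]
    | succ j =>
      rw [List.ofFn_succ, List.prod_cons, ih j (fun i => g i.succ) hj, List.ofFn_succ,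
        List.prod_cons]
      simp

/-- The ordered product of the `y j` with `j` outside the range of `π`. -/
def uncontractedProd {M : Type*} [Monoid M] {n C : ℕ} (π : Fin C → Fin n) (y : Fin n → M) : M :=
  (List.ofFn fun j => if ∃ c, π c = j then (1 : M) else y j).prod

/-- The product, in reverse order, of the `x i` with `i` outside the range of `π`. -/
def uncontractedRevProd {M : Type*} [Monoid M] {n C : ℕ} (π : Fin C → Fin n) (x : Fin n → M) : M :=
  (List.ofFn fun i => if ∃ c, π c = i then (1 : M) else x i).reverse.prod

lemma uncontractedProd_consAbove {M : Type*} [Monoid M] {n C : ℕ} (j : Fin (n + 1))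
    (π : Fin C → Fin n) (y : Fin (n + 1) → M) :
    uncontractedProd (consAbove j π) y = uncontractedProd π fun i => y (j.succAbove i) := by
  unfold uncontractedProd
  have h0 : (if ∃ c, consAbove j π c = j then (1 : M) else y j) = 1 := if_pos ⟨0, rfl⟩
  rw [prod_ofFn_succAbove j (fun k => if ∃ c, consAbove j π c = k then (1 : M) else y k) h0]
  simp [Fin.exists_fin_succ, Fin.ne_succAbove]

lemma uncontractedRevProd_castSucc {M : Type*} [Monoid M] {n C : ℕ} (π : Fin C → Fin n)
    (x : Fin (n + 1) → M) :
    uncontractedRevProd (Fin.castSucc ∘ π) x =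
      x (Fin.last n) * uncontractedRevProd π fun i => x i.castSucc := by
  rw [uncontractedRevProd, List.ofFn_succ_last]
  simp [uncontractedRevProd]

lemma uncontractedRevProd_consAbove_last {M : Type*} [Monoid M] {n C : ℕ} (π : Fin C → Fin n)
    (x : Fin (n + 1) → M) :
    uncontractedRevProd (consAbove (Fin.last n) π) x =
      uncontractedRevProd π fun i => x i.castSucc := by
  rw [uncontractedRevProd, List.ofFn_succ_last]
  simp [uncontractedRevProd, Fin.exists_fin_succ, (Fin.castSucc_ne_last _).symm]

lemma prod_ofFn_mul_of_anticomm {m : ℕ} (y : Fin (m + 1) → R) (x : R) (d : Fin (m + 1) → ℂ)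
    (h : ∀ j, y j * x + x * y j = algebraMap ℂ R (d j)) :
    (List.ofFn y).prod * x =
      ((-1 : ℂ) ^ (m + 1)) • (x * (List.ofFn y).prod) +
        ∑ j : Fin (m + 1), ((-1 : ℂ) ^ (m + j : ℕ) * d j) •
          (List.ofFn fun i => y (j.succAbove i)).prod := by
  have hc : ∀ j, y j * x = d j • (1 : R) - x * y j := by
    intro j
    rw [← Algebra.algebraMap_eq_smul_one, ← h j, add_sub_cancel_right]
  induction m with
  | zero => simp [hc]; abel
  | succ m ih =>
    rw [List.ofFn_succ, List.prod_cons, mul_assoc,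
      ih (fun j => y j.succ) (fun j => d j.succ) (fun j => h j.succ) (fun j => hc j.succ),
      Fin.sum_univ_succ (n := m + 1), mul_add, mul_smul_comm, ← mul_assoc, hc 0, sub_mul,
      Finset.mul_sum]
    have hpow : ∀ j : Fin (m + 1),
        (-1 : ℂ) ^ (m + 1 + ((j.succ : Fin (m + 2)) : ℕ)) = (-1) ^ (m + j : ℕ) := by
      intro j
      rw [Fin.val_succ, show m + 1 + ((j : ℕ) + 1) = m + j + 2 by ring, pow_add]
      norm_num
    simp only [hpow, mul_smul_comm, List.ofFn_succ, Fin.succ_succAbove_zero,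
      Fin.succ_succAbove_succ, List.prod_cons, Fin.zero_succAbove, Fin.val_zero, add_zero,
      smul_mul_assoc, one_mul, smul_sub, mul_assoc]
    module

/-- The contribution to the normal ordering of `∏ y · ∏ x` of all configurations with
`C` contractions, weighted by the contraction matrix `d`. -/
def contractionSum {n m : ℕ} (C : ℕ) (x : Fin n → R) (y : Fin m → R) (d : Fin n → Fin m → ℂ) : R :=
  ∑ π ∈ Finset.univ.filter (fun π : Fin C → Fin n => StrictAnti π),
    ∑ π' ∈ Finset.univ.filter (fun π' : Fin C → Fin m => Function.Injective π'),
      ((configSign π π' : ℂ) * ∏ c, d (π c) (π' c)) •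
        (uncontractedRevProd π x * uncontractedProd π' y)

lemma contractionSum_zero {n m : ℕ} (x : Fin n → R) (y : Fin m → R) (d : Fin n → Fin m → ℂ) :
    contractionSum 0 x y d =
      ((-1 : ℂ) ^ (m * n)) • ((List.ofFn x).reverse.prod * (List.ofFn y).prod) := by
  have h₁ : (Finset.univ.filter fun π : Fin 0 → Fin n => StrictAnti π) = Finset.univ :=
    Finset.filter_true_of_mem fun _ _ c => c.elim0
  have h₂ : (Finset.univ.filter fun π : Fin 0 → Fin m => Function.Injective π) = Finset.univ :=
    Finset.filter_true_of_mem fun _ _ c => c.elim0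
  rw [contractionSum, h₁, h₂]
  simp [configSign_of_isEmpty, uncontractedRevProd, uncontractedProd]

lemma contractionSum_of_lt {n m C : ℕ} (h : min m n < C) (x : Fin n → R) (y : Fin m → R)
    (d : Fin n → Fin m → ℂ) : contractionSum C x y d = 0 := by
  refine Finset.sum_eq_zero fun π hπ => Finset.sum_eq_zero fun π' hπ' => ?_
  simp only [Finset.mem_filter, Finset.mem_univ, true_and] at hπ hπ'
  have hn : C ≤ n := by simpa using Fintype.card_le_of_injective π hπ.injective
  have hm : C ≤ m := by simpa using Fintype.card_le_of_injective π' hπ'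
  omega

lemma sum_castSucc_term {n m C : ℕ} (x : Fin (n + 1) → R) (y : Fin m → R)
    (d : Fin (n + 1) → Fin m → ℂ) :
    ∑ π ∈ Finset.univ.filter (fun π : Fin C → Fin n => StrictAnti π),
      ∑ π' ∈ Finset.univ.filter (fun π' : Fin C → Fin m => Function.Injective π'),
        ((configSign (Fin.castSucc ∘ π) π' : ℂ) * ∏ c, d ((Fin.castSucc ∘ π) c) (π' c)) •
          (uncontractedRevProd (Fin.castSucc ∘ π) x * uncontractedProd π' y) =
      ((-1 : ℂ) ^ m) • (x (Fin.last n) *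
        contractionSum C (fun i => x i.castSucc) y fun i => d i.castSucc) := by
  simp only [contractionSum, Finset.mul_sum, Finset.smul_sum]
  refine Finset.sum_congr rfl fun π hπ => Finset.sum_congr rfl fun π' hπ' => ?_
  simp only [Finset.mem_filter, Finset.mem_univ, true_and] at hπ hπ'
  rw [configSign_castSucc hπ.injective hπ', uncontractedRevProd_castSucc, mul_smul_comm,
    smul_smul, mul_assoc (x _)]
  push_cast
  simp only [mul_assoc, Function.comp_apply]

lemma contractionSum_succ_zero {n m : ℕ} (x : Fin (n + 1) → R) (y : Fin m → R)
    (d : Fin (n + 1) → Fin m → ℂ) :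
    contractionSum 0 x y d = ((-1 : ℂ) ^ m) • (x (Fin.last n) *
        contractionSum 0 (fun i => x i.castSucc) y fun i => d i.castSucc) := by
  rw [contractionSum_zero, contractionSum_zero, List.ofFn_succ_last, mul_smul_comm, smul_smul,
    ← pow_add]
  simp only [List.reverse_append, List.prod_append, List.reverse_singleton, List.prod_singleton,
    mul_assoc]
  congr 2
  ring

lemma contractionSum_succ_succ {n m C : ℕ} (x : Fin (n + 1) → R) (y : Fin (m + 1) → R)
    (d : Fin (n + 1) → Fin (m + 1) → ℂ) :
    contractionSum (C + 1) x y d =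
      ((-1 : ℂ) ^ (m + 1)) • (x (Fin.last n) *
        contractionSum (C + 1) (fun i => x i.castSucc) y fun i => d i.castSucc) +
      ∑ j : Fin (m + 1), ((-1 : ℂ) ^ (m + j : ℕ) * d (Fin.last n) j) •
        contractionSum C (fun i => x i.castSucc) (fun i => y (j.succAbove i))
          fun i k => d i.castSucc (j.succAbove k) := by
  rw [contractionSum, sum_strictAnti_succ, sum_castSucc_term]
  congr 1
  simp only [sum_injective_succ, contractionSum, Finset.smul_sum]
  rw [Finset.sum_comm]
  refine Finset.sum_congr rfl fun j _ => Finset.sum_congr rfl fun π hπ =>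
    Finset.sum_congr rfl fun π' hπ' => ?_
  simp only [Finset.mem_filter, Finset.mem_univ, true_and] at hπ hπ'
  rw [configSign_consAbove hπ.injective hπ', uncontractedRevProd_consAbove_last,
    uncontractedProd_consAbove, smul_smul, Fin.prod_univ_succ]
  simp only [consAbove_zero, consAbove_succ, Fin.succAbove_last]
  push_cast
  congr 1
  ring

/-- Wick expansion of an ordered product of two families whose mutual anticommutators are
scalars. -/
theorem prod_mul_reverse_prod_eq_sum_contractionSum {n : ℕ} : ∀ {m : ℕ} (x : Fin n → R)
    (y : Fin m → R) (d : Fin n → Fin m → ℂ),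
    (∀ i j, y j * x i + x i * y j = algebraMap ℂ R (d i j)) →
      (List.ofFn y).prod * (List.ofFn x).reverse.prod =
        ∑ C ∈ Finset.range (n + 1), contractionSum C x y d := by
  induction n with
  | zero => intro m x y d _; simp [contractionSum_zero]
  | succ n ih =>
    intro m x y d h
    obtain _ | m := m
    · rw [Finset.sum_eq_single 0]
      · simp [contractionSum_zero]
      · intro C _ hC
        exact contractionSum_of_lt (by omega) _ _ _
      · simp
    · have ih₁ := ih (fun i => x i.castSucc) y (fun i => d i.castSucc) fun i j => h _ j
      have ih₂ := fun j : Fin (m + 1) => ih (fun i => x i.castSucc) (fun i => y (j.succAbove i))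
        (fun i k => d i.castSucc (j.succAbove k)) fun i k => h _ _
      have hlast : contractionSum (n + 1) (fun i => x i.castSucc) y (fun i => d i.castSucc) = 0 :=
        contractionSum_of_lt (by omega) _ _ _
      rw [Finset.sum_range_succ', contractionSum_succ_zero]
      simp only [contractionSum_succ_succ]
      rw [Finset.sum_add_distrib, ← Finset.smul_sum, ← Finset.mul_sum, Finset.sum_comm,
        add_right_comm, ← smul_add, ← mul_add, ← Finset.sum_range_succ'
          (fun C => contractionSum C (fun i => x i.castSucc) y fun i => d i.castSucc),
        Finset.sum_range_succ,
        hlast, add_zero, ← ih₁]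
      simp only [← Finset.smul_sum, ← ih₂]
      rw [List.ofFn_succ_last (f := x)]
      simp only [List.reverse_append, List.prod_append, List.reverse_singleton,
        List.prod_singleton]
      rw [← mul_assoc, prod_ofFn_mul_of_anticomm y _ _ fun j => h (Fin.last n) j, add_mul,
        Finset.sum_mul, smul_mul_assoc, mul_assoc]
      simp only [smul_mul_assoc]

lemma sum_range_contractionSum {n m : ℕ} (x : Fin n → R) (y : Fin m → R)
    (d : Fin n → Fin m → ℂ) :
    ∑ C ∈ Finset.range (n + 1), contractionSum C x y d =
      contractionSum 0 x y d + ∑ C ∈ Finset.Icc 1 (min m n), contractionSum C x y d := by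
  rw [Finset.range_eq_Ico, Finset.sum_eq_sum_Ico_succ_bot (Nat.succ_pos n)]
  congr 1
  symm
  refine Finset.sum_subset (fun C hC => ?_) fun C _ hC => contractionSum_of_lt ?_ _ _ _
  · simp only [Finset.mem_Icc, Finset.mem_Ico] at hC ⊢
    omega
  · simp only [Finset.mem_Icc, Finset.mem_Ico] at *
    omega

/-- Contraction formula for a single pair of monomials. -/
lemma monomial_mul_monomial (a adag : ι → R)
    (hcar : ∀ i j, a i * adag j + adag j * a i = if i = j then 1 else 0)
    {n m : ℕ} (X : Fin n → ι) (Y : Fin m → ι) (l r : R) :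
    (l * (List.ofFn fun j => a (Y j)).prod) * ((List.ofFn fun i => adag (X i)).reverse.prod * r) =
      ((-1 : ℂ) ^ (m * n)) • (l * (List.ofFn fun i => adag (X i)).reverse.prod *
        (List.ofFn fun j => a (Y j)).prod * r) +
      ∑ C ∈ Finset.Icc 1 (min m n),
        ∑ π ∈ Finset.univ.filter (fun π : Fin C → Fin n => StrictAnti π),
          ∑ π' ∈ Finset.univ.filter (fun π' : Fin C → Fin m => Function.Injective π'),
            ((configSign π π' : ℂ) * ∏ c : Fin C, if X (π c) = Y (π' c) then (1 : ℂ) else 0) •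
              (l * uncontractedRevProd π (fun i => adag (X i)) *
                uncontractedProd π' (fun j => a (Y j)) * r) := by
  have h := prod_mul_reverse_prod_eq_sum_contractionSum (fun i => adag (X i)) (fun j => a (Y j))
    (fun i j => if X i = Y j then (1 : ℂ) else 0) fun i j => by
      rw [hcar]
      by_cases e : X i = Y j
      · simp [e]
      · simp [e, Ne.symm e]
  rw [sum_range_contractionSum, contractionSum_zero] at h
  rw [mul_assoc, ← mul_assoc _ _ r, h, add_mul, mul_add]
  simp only [contractionSum, Finset.sum_mul, Finset.mul_sum, smul_mul_assoc, mul_smul_comm,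
    mul_assoc]

/-- **Fermionic contraction formula** (Lemma 3.4, discrete-mode form):
if `a, a⁺` satisfy the CAR, then
`Op(f_A) Op(f_B) = (−1)^{m_A n_B} :Op(f_A)Op(f_B): + Op(f_A) Γ₋ Op(f_B)`. -/
theorem fermionic_contraction_formula (a adag : ι → R)
    (hcar1 : ∀ i j, a i * adag j + adag j * a i = if i = j then 1 else 0)
    (hcar2 : ∀ i j, a i * a j + a j * a i = 0)
    (hcar3 : ∀ i j, adag i * adag j + adag j * adag i = 0)
    {nA mA nB mB : ℕ}
    (fA : ((Fin nA → ι) × (Fin mA → ι)) →₀ ℂ)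
    (fB : ((Fin nB → ι) × (Fin mB → ι)) →₀ ℂ) :
    FOp a adag fA * FOp a adag fB =
      ((-1 : ℂ) ^ (mA * nB)) • FNormal a adag fA fB + FAttachF a adag fA fB := by
  simp only [FOp, FNormal, FAttachF, Finsupp.sum, Finset.sum_mul_sum, Finset.smul_sum]
  have swap : ∀ (s : Finset ((Fin nA → ι) × (Fin mA → ι)))
      (t : Finset ((Fin nB → ι) × (Fin mB → ι)))
      (F : (C : ℕ) → (Fin C → Fin nB) → (Fin C → Fin mA) → (Fin nA → ι) × (Fin mA → ι) →
        (Fin nB → ι) × (Fin mB → ι) → R),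
      ∑ C ∈ Finset.Icc 1 (min mA nB),
        ∑ π ∈ Finset.univ.filter (fun π : Fin C → Fin nB => StrictAnti π),
          ∑ π' ∈ Finset.univ.filter (fun π' : Fin C → Fin mA => Function.Injective π'),
            ∑ p ∈ s, ∑ q ∈ t, F C π π' p q =
      ∑ p ∈ s, ∑ q ∈ t, ∑ C ∈ Finset.Icc 1 (min mA nB),
        ∑ π ∈ Finset.univ.filter (fun π : Fin C → Fin nB => StrictAnti π),
          ∑ π' ∈ Finset.univ.filter (fun π' : Fin C → Fin mA => Function.Injective π'),
            F C π π' p q := by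
    intro s t F
    simp only [← Finset.sum_product' s t]
    symm
    refine Finset.sum_comm.trans (Finset.sum_congr rfl fun C _ => ?_)
    exact Finset.sum_comm.trans (Finset.sum_congr rfl fun π _ => Finset.sum_comm)
  rw [swap, ← Finset.sum_add_distrib]
  refine Finset.sum_congr rfl fun p _ => ?_
  rw [← Finset.sum_add_distrib]
  refine Finset.sum_congr rfl fun q _ => ?_
  rw [smul_mul_smul_comm, monomial_mul_monomial a adag hcar1, smul_add]
  congr 1
  · rw [smul_comm]
  · simp only [Finset.smul_sum, smul_smul]
    refine Finset.sum_congr rfl fun C _ => Finset.sum_congr rfl fun π _ =>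
      Finset.sum_congr rfl fun π' _ => ?_
    congr 1
    ring
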